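/- Let L be a pseudo-Finsler Lagrangian on Ω with spray nonlinear connection N, and define the curvature endomorphism R^α_β(x,v) := R^α{}_{βμ}(x,v)v^μ. Then at every (x,v) ∈ Ω: (i) R^α_β v^β = 0 for all α; (ii) g_{αμ}(x,v) v^α R^μ_β(x,v) = 0 for all β; (iii) g_{αμ}(x,v) R^μ_β(x,v) = g_{βμ}(x,v) R^μ_α(x,v) for all α, β (i.e. the curvature endomorphism is self-adjoint with respect to g). -/

import Mathlib

open scoped BigOperators

noncomputable section

/-- `Vec m` is the model space `ℝ^m`. -/
abbrev Vec (m : ℕ) : Type := Fin m → ℝ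

variable {m : ℕ}

/-- Partial derivative in the velocity (second) variable: `∂f/∂v^i (x,v)`. -/
def pdv (f : Vec m → Vec m → ℝ) (i : Fin m) (x v : Vec m) : ℝ :=
  fderiv ℝ (f x) v (Pi.single i 1)

/-- Partial derivative in the position (first) variable: `∂f/∂x^i (x,v)`. -/
def pdx (f : Vec m → Vec m → ℝ) (i : Fin m) (x v : Vec m) : ℝ :=
  fderiv ℝ (fun y => f y v) x (Pi.single i 1)

/-- Vertical Hessian `g_{αβ}(x,v) = ∂²L/∂v^α∂v^β` of the Lagrangian. -/
def gmet (L : Vec m → Vec m → ℝ) (x v : Vec m) : Matrix (Fin m) (Fin m) ℝ :=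
  Matrix.of fun α β => pdv (pdv L β) α x v

/-- Inverse metric `g^{αβ}` (nonsingular matrix inverse). -/
def ginv (L : Vec m → Vec m → ℝ) (x v : Vec m) : Matrix (Fin m) (Fin m) ℝ :=
  (gmet L x v)⁻¹

/-- Geodesic spray coefficients
`G^α = (1/4) g^{αδ}(∂g_{δγ}/∂x^β + ∂g_{δβ}/∂x^γ − ∂g_{βγ}/∂x^δ) v^β v^γ`. -/
def spray (L : Vec m → Vec m → ℝ) (α : Fin m) (x v : Vec m) : ℝ :=
  (1/4) * ∑ δ, ginv L x v α δ *
    (∑ β, ∑ γ,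
      (pdx (fun y w => gmet L y w δ γ) β x v
        + pdx (fun y w => gmet L y w δ β) γ x v
        - pdx (fun y w => gmet L y w β γ) δ x v) * v β * v γ)

/-- The spray nonlinear connection `N^α_μ = ∂G^α/∂v^μ`. -/
def nConn (L : Vec m → Vec m → ℝ) (α μ : Fin m) (x v : Vec m) : ℝ :=
  pdv (spray L α) μ x v

/-- Horizontal derivative `δ_μ f = ∂f/∂x^μ − N^ν_μ ∂f/∂v^ν` for a nonlinear connection `N`. -/
def hderiv (N : Fin m → Fin m → Vec m → Vec m → ℝ) (f : Vec m → Vec m → ℝ)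
    (μ : Fin m) (x v : Vec m) : ℝ :=
  pdx f μ x v - ∑ ν, N ν μ x v * pdv f ν x v

/-- Curvature of the nonlinear connection: `R^μ_{αβ} = δ_α N^μ_β − δ_β N^μ_α`. -/
def curv (N : Fin m → Fin m → Vec m → Vec m → ℝ) (μ α β : Fin m) (x v : Vec m) : ℝ :=
  hderiv N (N μ β) α x v - hderiv N (N μ α) β x v

/-- Ricci scalar `Ric(v) = R^μ{}_{μα} v^α`. -/
def ricciScalar (N : Fin m → Fin m → Vec m → Vec m → ℝ) (x v : Vec m) : ℝ :=
  ∑ α, (∑ μ, curv N μ μ α x v) * v α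

/-- Ricci 1-form component `(Ric_v)_α = R^μ{}_{μα}`. -/
def ricciOne (N : Fin m → Fin m → Vec m → Vec m → ℝ) (α : Fin m) (x v : Vec m) : ℝ :=
  ∑ μ, curv N μ μ α x v

/-- `χ_α := (∂R^γ{}_{αν}/∂v^γ) v^ν`. -/
def chiForm (N : Fin m → Fin m → Vec m → Vec m → ℝ) (α : Fin m) (x v : Vec m) : ℝ :=
  ∑ γ, ∑ ν, pdv (curv N γ α ν) γ x v * v ν

/-- Partial derivative `∂u^α/∂x^μ` of a vector field on the base. -/
def pde (u : Vec m → Vec m) (α μ : Fin m) (x : Vec m) : ℝ :=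
  fderiv ℝ (fun y => u y α) x (Pi.single μ 1)

/-- Covariant derivative `(D_X u)^α = (∂u^α/∂x^μ + N^α_μ(x,u(x))) X^μ`. -/
def covD (L : Vec m → Vec m → ℝ) (u X : Vec m → Vec m) (x : Vec m) : Vec m :=
  fun α => ∑ μ, (pde u α μ x + nConn L α μ x (u x)) * X x μ

/-- Flipped derivative `(D̃_u X)^α = (∂X^α/∂x^μ) u^μ + N^α_μ(x,u(x)) X^μ`. -/
def flipD (L : Vec m → Vec m → ℝ) (u X : Vec m → Vec m) (x : Vec m) : Vec m :=
  fun α => (∑ μ, pde X α μ x * u x μ) + ∑ μ, nConn L α μ x (u x) * X x μ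

/-- Lie bracket `[X,Y]^α = X^μ ∂Y^α/∂x^μ − Y^μ ∂X^α/∂x^μ`. -/
def lieB (X Y : Vec m → Vec m) (x : Vec m) : Vec m :=
  fun α => ∑ μ, (X x μ * pde Y α μ x - Y x μ * pde X α μ x)

/-- Scalar product `g_u(X,Y)(x) = g_{αβ}(x,u(x)) X^α Y^β`. -/
def gProd (L : Vec m → Vec m → ℝ) (u X Y : Vec m → Vec m) (x : Vec m) : ℝ :=
  ∑ α, ∑ β, gmet L x (u x) α β * X x α * Y x β

/-- Directional derivative `∂_X f = X^μ ∂f/∂x^μ`. -/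
def dirD (X : Vec m → Vec m) (f : Vec m → ℝ) (x : Vec m) : ℝ :=
  ∑ μ, X x μ * fderiv ℝ f x (Pi.single μ 1)


/-- The curvature endomorphism `R^α_β(x,v) = R^α{}_{βμ}(x,v) v^μ`. -/
def curvEndo (L : Vec m → Vec m → ℝ) (α β : Fin m) (x v : Vec m) : ℝ :=
  ∑ μ, curv (nConn L) α β μ x v * v μ

/-- Smoothness on `Ω` of a function of `(x,v)`. -/
def Sm (Ω : Set (Vec m × Vec m)) (f : Vec m → Vec m → ℝ) : Prop :=
  ContDiffOn ℝ (⊤ : ℕ∞) (fun p : Vec m × Vec m => f p.1 p.2) Ω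

section basic

variable {Ω : Set (Vec m × Vec m)} {f h : Vec m → Vec m → ℝ} {x v : Vec m}

lemma Sm.diffAt (hf : Sm Ω f) (hO : IsOpen Ω) (hp : (x, v) ∈ Ω) :
    DifferentiableAt ℝ (fun p : Vec m × Vec m => f p.1 p.2) (x, v) :=
  (hf.contDiffAt (hO.mem_nhds hp)).differentiableAt (by simp)

lemma Sm.pdv_eq (hf : Sm Ω f) (hO : IsOpen Ω) (hp : (x, v) ∈ Ω) (i : Fin m) :
    pdv f i x v = fderiv ℝ (fun p : Vec m × Vec m => f p.1 p.2) (x, v) (0, Pi.single i 1) := by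
  have h1 := (hf.diffAt hO hp).hasFDerivAt
  have h2 : HasFDerivAt (fun w : Vec m => ((x, w) : Vec m × Vec m))
      (ContinuousLinearMap.inr ℝ (Vec m) (Vec m)) v := hasFDerivAt_prodMk_right x v
  have h3 := HasFDerivAt.comp v h1 h2
  have h4 : HasFDerivAt (f x) _ v := h3
  rw [pdv, h4.fderiv]
  simp

lemma Sm.pdx_eq (hf : Sm Ω f) (hO : IsOpen Ω) (hp : (x, v) ∈ Ω) (i : Fin m) :
    pdx f i x v = fderiv ℝ (fun p : Vec m × Vec m => f p.1 p.2) (x, v) (Pi.single i 1, 0) := by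
  have h1 := (hf.diffAt hO hp).hasFDerivAt
  have h2 : HasFDerivAt (fun w : Vec m => ((w, v) : Vec m × Vec m))
      (ContinuousLinearMap.inl ℝ (Vec m) (Vec m)) x := hasFDerivAt_prodMk_left x v
  have h3 := HasFDerivAt.comp x h1 h2
  have h4 : HasFDerivAt (fun y => f y v) _ x := h3
  rw [pdx, h4.fderiv]
  simp

lemma Sm.congr (hf : Sm Ω f) (e : ∀ x v, (x, v) ∈ Ω → h x v = f x v) : Sm Ω h :=
  ContDiffOn.congr hf (fun p hp => e p.1 p.2 hp)

lemma sm_fderiv (hf : Sm Ω f) (hO : IsOpen Ω) (w : Vec m × Vec m) :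
    ContDiffOn ℝ (⊤ : ℕ∞)
      (fun p => fderiv ℝ (fun p : Vec m × Vec m => f p.1 p.2) p w) Ω := by
  have : ContDiffOn ℝ (⊤ : ℕ∞) (fderiv ℝ (fun p : Vec m × Vec m => f p.1 p.2)) Ω :=
    hf.fderiv_of_isOpen hO (by simp)
  exact this.clm_apply contDiffOn_const

lemma Sm.pdv (hf : Sm Ω f) (hO : IsOpen Ω) (i : Fin m) : Sm Ω (pdv f i) :=
  (sm_fderiv hf hO (0, Pi.single i 1)).congr (fun p hp => hf.pdv_eq (x := p.1) (v := p.2) hO hp i)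

lemma Sm.pdx (hf : Sm Ω f) (hO : IsOpen Ω) (i : Fin m) : Sm Ω (pdx f i) :=
  (sm_fderiv hf hO (Pi.single i 1, 0)).congr (fun p hp => hf.pdx_eq (x := p.1) (v := p.2) hO hp i)

lemma Sm.mul (hf : Sm Ω f) (hh : Sm Ω h) : Sm Ω (fun x v => f x v * h x v) :=
  ContDiffOn.mul hf hh

lemma Sm.add (hf : Sm Ω f) (hh : Sm Ω h) : Sm Ω (fun x v => f x v + h x v) :=
  ContDiffOn.add hf hh

lemma Sm.sub (hf : Sm Ω f) (hh : Sm Ω h) : Sm Ω (fun x v => f x v - h x v) :=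
  ContDiffOn.sub hf hh

lemma Sm.const (c : ℝ) : Sm Ω (fun _ _ => c) := contDiffOn_const

lemma Sm.sum {ι : Type*} {s : Finset ι} {F : ι → Vec m → Vec m → ℝ} (hF : ∀ i, Sm Ω (F i)) :
    Sm Ω (fun x v => ∑ i ∈ s, F i x v) :=
  ContDiffOn.sum (fun i _ => hF i)

lemma Sm.prod {ι : Type*} {s : Finset ι} {F : ι → Vec m → Vec m → ℝ} (hF : ∀ i, Sm Ω (F i)) :
    Sm Ω (fun x v => ∏ i ∈ s, F i x v) :=
  contDiffOn_prod (fun i _ => hF i)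

lemma Sm.coord (i : Fin m) : Sm Ω (fun _ v => v i) := by
  have : ContDiff ℝ (⊤ : ℕ∞) (fun p : Vec m × Vec m => p.2 i) := by fun_prop
  exact this.contDiffOn

lemma ev_slice_v (hO : IsOpen Ω) (hp : (x, v) ∈ Ω) : ∀ᶠ w in nhds v, (x, w) ∈ Ω :=
  (by fun_prop : Continuous fun w : Vec m => (x, w)).continuousAt.eventually (hO.mem_nhds hp)

lemma ev_slice_x (hO : IsOpen Ω) (hp : (x, v) ∈ Ω) : ∀ᶠ y in nhds x, (y, v) ∈ Ω :=
  (by fun_prop : Continuous fun y : Vec m => (y, v)).continuousAt.eventually (hO.mem_nhds hp)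

lemma pdv_congr (hO : IsOpen Ω) (e : ∀ x v, (x, v) ∈ Ω → f x v = h x v) (hp : (x, v) ∈ Ω)
    (i : Fin m) : pdv f i x v = pdv h i x v := by
  have : f x =ᶠ[nhds v] h x := by
    filter_upwards [ev_slice_v hO hp] with w hw using e x w hw
  rw [pdv, pdv, this.fderiv_eq]

lemma pdx_congr (hO : IsOpen Ω) (e : ∀ x v, (x, v) ∈ Ω → f x v = h x v) (hp : (x, v) ∈ Ω)
    (i : Fin m) : pdx f i x v = pdx h i x v := by
  have : (fun y => f y v) =ᶠ[nhds x] (fun y => h y v) := by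
    filter_upwards [ev_slice_x hO hp] with w hw using e w v hw
  rw [pdx, pdx, this.fderiv_eq]

lemma Sm.dv (hf : Sm Ω f) (hO : IsOpen Ω) (hp : (x, v) ∈ Ω) : DifferentiableAt ℝ (f x) v :=
  DifferentiableAt.comp (g := fun p : Vec m × Vec m => f p.1 p.2) (f := fun w => (x, w)) v
    (hf.diffAt hO hp) (by fun_prop)

lemma Sm.dx (hf : Sm Ω f) (hO : IsOpen Ω) (hp : (x, v) ∈ Ω) :
    DifferentiableAt ℝ (fun y => f y v) x :=
  DifferentiableAt.comp (g := fun p : Vec m × Vec m => f p.1 p.2) (f := fun y => (y, v)) x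
    (hf.diffAt hO hp) (by fun_prop)

lemma pdv_mul (hf : Sm Ω f) (hh : Sm Ω h) (hO : IsOpen Ω) (hp : (x, v) ∈ Ω) (i : Fin m) :
    pdv (fun x v => f x v * h x v) i x v = pdv f i x v * h x v + f x v * pdv h i x v := by
  have := fderiv_fun_mul (hf.dv hO hp) (hh.dv hO hp)
  simp only [pdv]
  rw [this]
  simp
  ring

lemma pdx_mul (hf : Sm Ω f) (hh : Sm Ω h) (hO : IsOpen Ω) (hp : (x, v) ∈ Ω) (i : Fin m) :
    pdx (fun x v => f x v * h x v) i x v = pdx f i x v * h x v + f x v * pdx h i x v := by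
  have := fderiv_fun_mul (hf.dx hO hp) (hh.dx hO hp)
  simp only [pdx]
  rw [this]
  simp
  ring

lemma pdv_sub (hf : Sm Ω f) (hh : Sm Ω h) (hO : IsOpen Ω) (hp : (x, v) ∈ Ω) (i : Fin m) :
    pdv (fun x v => f x v - h x v) i x v = pdv f i x v - pdv h i x v := by
  have := fderiv_fun_sub (hf.dv hO hp) (hh.dv hO hp)
  simp only [pdv]
  rw [this]
  simp

lemma pdx_sub (hf : Sm Ω f) (hh : Sm Ω h) (hO : IsOpen Ω) (hp : (x, v) ∈ Ω) (i : Fin m) :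
    pdx (fun x v => f x v - h x v) i x v = pdx f i x v - pdx h i x v := by
  have := fderiv_fun_sub (hf.dx hO hp) (hh.dx hO hp)
  simp only [pdx]
  rw [this]
  simp

lemma pdv_smul (c : ℝ) (hf : Sm Ω f) (hO : IsOpen Ω) (hp : (x, v) ∈ Ω) (i : Fin m) :
    pdv (fun x v => c * f x v) i x v = c * pdv f i x v := by
  have := fderiv_const_mul (hf.dv hO hp) c
  simp only [pdv]
  rw [this]
  simp

lemma pdx_smul (c : ℝ) (hf : Sm Ω f) (hO : IsOpen Ω) (hp : (x, v) ∈ Ω) (i : Fin m) :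
    pdx (fun x v => c * f x v) i x v = c * pdx f i x v := by
  have := fderiv_const_mul (hf.dx hO hp) c
  simp only [pdx]
  rw [this]
  simp

lemma pdv_sum {F : Fin m → Vec m → Vec m → ℝ} (hF : ∀ i, Sm Ω (F i)) (hO : IsOpen Ω)
    (hp : (x, v) ∈ Ω) (i : Fin m) :
    pdv (fun x v => ∑ j, F j x v) i x v = ∑ j, pdv (F j) i x v := by
  simp only [pdv]
  rw [fderiv_fun_sum (fun j _ => (hF j).dv hO hp)]
  simp

lemma pdx_sum {F : Fin m → Vec m → Vec m → ℝ} (hF : ∀ i, Sm Ω (F i)) (hO : IsOpen Ω)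
    (hp : (x, v) ∈ Ω) (i : Fin m) :
    pdx (fun x v => ∑ j, F j x v) i x v = ∑ j, pdx (F j) i x v := by
  simp only [pdx]
  rw [fderiv_fun_sum (fun j _ => (hF j).dx hO hp)]
  simp

lemma pdv_sum_mul {F H : Fin m → Vec m → Vec m → ℝ} (hF : ∀ i, Sm Ω (F i)) (hH : ∀ i, Sm Ω (H i))
    (hO : IsOpen Ω) (hp : (x, v) ∈ Ω) (i : Fin m) :
    pdv (fun x v => ∑ j, F j x v * H j x v) i x v
      = ∑ j, (pdv (F j) i x v * H j x v + F j x v * pdv (H j) i x v) := by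
  rw [pdv_sum (F := fun j x v => F j x v * H j x v) (fun j => (hF j).mul (hH j)) hO hp]
  exact Finset.sum_congr rfl fun j _ => pdv_mul (hF j) (hH j) hO hp i

lemma pdx_sum_mul {F H : Fin m → Vec m → Vec m → ℝ} (hF : ∀ i, Sm Ω (F i)) (hH : ∀ i, Sm Ω (H i))
    (hO : IsOpen Ω) (hp : (x, v) ∈ Ω) (i : Fin m) :
    pdx (fun x v => ∑ j, F j x v * H j x v) i x v
      = ∑ j, (pdx (F j) i x v * H j x v + F j x v * pdx (H j) i x v) := by
  rw [pdx_sum (F := fun j x v => F j x v * H j x v) (fun j => (hF j).mul (hH j)) hO hp]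
  exact Finset.sum_congr rfl fun j _ => pdx_mul (hF j) (hH j) hO hp i

lemma pdv_coord (j i : Fin m) : pdv (fun _ v => v j) i x v = if j = i then 1 else 0 := by
  have : HasFDerivAt (fun v : Vec m => v j)
    (ContinuousLinearMap.proj (R := ℝ) (φ := fun _ : Fin m => ℝ) j) v := hasFDerivAt_apply j v
  rw [pdv, this.fderiv]
  simp [Pi.single_apply]

lemma pdx_coord (j i : Fin m) : pdx (fun _ v => v j) i x v = 0 := by
  simp [pdx]

lemma pdv_vsum {H : Fin m → Vec m → Vec m → ℝ} (hH : ∀ i, Sm Ω (H i))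
    (hO : IsOpen Ω) (hp : (x, v) ∈ Ω) (i : Fin m) :
    pdv (fun x v => ∑ j, v j * H j x v) i x v = H i x v + ∑ j, v j * pdv (H j) i x v := by
  rw [pdv_sum_mul (F := fun j _ v => v j) (fun j => Sm.coord j) hH hO hp]
  simp [pdv_coord, Finset.sum_add_distrib]

lemma pdx_vsum {H : Fin m → Vec m → Vec m → ℝ} (hH : ∀ i, Sm Ω (H i))
    (hO : IsOpen Ω) (hp : (x, v) ∈ Ω) (i : Fin m) :
    pdx (fun x v => ∑ j, v j * H j x v) i x v = ∑ j, v j * pdx (H j) i x v := by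
  rw [pdx_sum_mul (F := fun j _ v => v j) (fun j => Sm.coord j) hH hO hp]
  simp [pdx_coord]

lemma dd_comm (hf : Sm Ω f) (hO : IsOpen Ω) {p : Vec m × Vec m} (hp : p ∈ Ω)
    (a b : Vec m × Vec m) :
    fderiv ℝ (fun q => fderiv ℝ (fun p : Vec m × Vec m => f p.1 p.2) q a) p b
      = fderiv ℝ (fun q => fderiv ℝ (fun p : Vec m × Vec m => f p.1 p.2) q b) p a := by
  have hc := hf.contDiffAt (hO.mem_nhds hp)
  have hs : IsSymmSndFDerivAt ℝ (fun p : Vec m × Vec m => f p.1 p.2) p :=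
    hc.isSymmSndFDerivAt (by
      rw [minSmoothness_of_isRCLikeNormedField]; exact WithTop.coe_le_coe.2 (le_top : (2 : ℕ∞) ≤ ⊤))
  have hd : DifferentiableAt ℝ (fderiv ℝ (fun p : Vec m × Vec m => f p.1 p.2)) p :=
    (hc.fderiv_right (m := 1) (by norm_cast)).differentiableAt (by simp)
  rw [fderiv_clm_apply hd (by fun_prop), fderiv_clm_apply hd (by fun_prop)]
  simpa using hs.eq b a

lemma fderiv_congr_on {F H : Vec m × Vec m → ℝ} (hO : IsOpen Ω) (e : ∀ p ∈ Ω, F p = H p)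
    {p : Vec m × Vec m} (hp : p ∈ Ω) : fderiv ℝ F p = fderiv ℝ H p :=
  Filter.EventuallyEq.fderiv_eq (by filter_upwards [hO.mem_nhds hp] with q hq using e q hq)

lemma pdv_pdv_comm (hf : Sm Ω f) (hO : IsOpen Ω) (hp : (x, v) ∈ Ω) (i j : Fin m) :
    pdv (pdv f i) j x v = pdv (pdv f j) i x v := by
  rw [(hf.pdv hO i).pdv_eq hO hp, (hf.pdv hO j).pdv_eq hO hp,
    fderiv_congr_on hO (fun p hp => hf.pdv_eq (x := p.1) (v := p.2) hO hp i) hp,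
    fderiv_congr_on hO (fun p hp => hf.pdv_eq (x := p.1) (v := p.2) hO hp j) hp]
  exact dd_comm hf hO hp _ _

lemma pdx_pdx_comm (hf : Sm Ω f) (hO : IsOpen Ω) (hp : (x, v) ∈ Ω) (i j : Fin m) :
    pdx (pdx f i) j x v = pdx (pdx f j) i x v := by
  rw [(hf.pdx hO i).pdx_eq hO hp, (hf.pdx hO j).pdx_eq hO hp,
    fderiv_congr_on hO (fun p hp => hf.pdx_eq (x := p.1) (v := p.2) hO hp i) hp,
    fderiv_congr_on hO (fun p hp => hf.pdx_eq (x := p.1) (v := p.2) hO hp j) hp]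
  exact dd_comm hf hO hp _ _

lemma pdv_pdx_comm (hf : Sm Ω f) (hO : IsOpen Ω) (hp : (x, v) ∈ Ω) (i j : Fin m) :
    pdv (pdx f i) j x v = pdx (pdv f j) i x v := by
  rw [(hf.pdx hO i).pdv_eq hO hp, (hf.pdv hO j).pdx_eq hO hp,
    fderiv_congr_on hO (fun p hp => hf.pdx_eq (x := p.1) (v := p.2) hO hp i) hp,
    fderiv_congr_on hO (fun p hp => hf.pdv_eq (x := p.1) (v := p.2) hO hp j) hp]
  exact dd_comm hf hO hp _ _

lemma fderiv_eq_sum : fderiv ℝ (f x) v v = ∑ i, v i * pdv f i x v := by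
  conv_lhs => rw [show fderiv ℝ (f x) v v = fderiv ℝ (f x) v (∑ i, v i • Pi.single i (1:ℝ)) by
    congr 1; exact pi_eq_sum_univ' v]
  simp [pdv]

lemma euler (hf : Sm Ω f) (hO : IsOpen Ω) (hp : (x, v) ∈ Ω)
    (hh : ∀ s : ℝ, 0 < s → f x (s • v) = s ^ 2 * f x v) :
    ∑ i, v i * pdv f i x v = 2 * f x v := by
  rw [← fderiv_eq_sum]
  have h1 : HasDerivAt (fun s : ℝ => s • v) v 1 := by
    simpa using (hasDerivAt_id (1:ℝ)).smul_const v
  have h0 : HasFDerivAt (f x) (fderiv ℝ (f x) v) ((1:ℝ) • v) := by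
    rw [one_smul]; exact (hf.dv hO hp).hasFDerivAt
  have h2 : HasDerivAt (fun s : ℝ => f x (s • v)) (fderiv ℝ (f x) v v) 1 :=
    h0.comp_hasDerivAt (1:ℝ) h1
  have h3 : HasDerivAt (fun s : ℝ => s ^ 2 * f x v) (2 * f x v) 1 := by
    simpa using (hasDerivAt_pow 2 (1:ℝ)).mul_const (f x v)
  refine h2.unique (h3.congr_of_eventuallyEq ?_)
  filter_upwards [lt_mem_nhds (zero_lt_one' ℝ)] with s hs using hh s hs

lemma Sm.det {A : Vec m → Vec m → Matrix (Fin m) (Fin m) ℝ}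
    (hA : ∀ i j, Sm Ω (fun x v => A x v i j)) : Sm Ω (fun x v => (A x v).det) := by
  simp only [Matrix.det_apply']
  exact Sm.sum fun σ => (Sm.const _).mul (Sm.prod fun i => hA _ _)

lemma Sm.inv {A : Vec m → Vec m → Matrix (Fin m) (Fin m) ℝ}
    (hA : ∀ i j, Sm Ω (fun x v => A x v i j)) (hdet : ∀ p ∈ Ω, IsUnit (A p.1 p.2).det)
    (i j : Fin m) : Sm Ω (fun x v => (A x v)⁻¹ i j) := by
  have h1 : Sm Ω (fun x v => ((A x v).det)⁻¹) :=
    ContDiffOn.inv (Sm.det hA) (fun p hp => (hdet p hp).ne_zero)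
  have h2 : Sm Ω (fun x v => (A x v).adjugate i j) := by
    simp only [Matrix.adjugate_apply]
    refine Sm.det fun a b => ?_
    simp only [Matrix.updateRow_apply]
    split_ifs
    · exact Sm.const _
    · exact hA a b
  simpa [Matrix.inv_def] using h1.mul h2

end basic

/-- The standing hypotheses. -/
structure PF (Ω : Set (Vec m × Vec m)) (L : Vec m → Vec m → ℝ) : Prop where
  op : IsOpen Ω
  sm : Sm Ω L
  hom : ∀ p ∈ Ω, ∀ s : ℝ, 0 < s → L p.1 (s • p.2) = s ^ 2 * L p.1 p.2
  inv : ∀ p ∈ Ω, IsUnit (gmet L p.1 p.2).det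

/-- The spray derivative `S f = v^ν ∂_ν f - 2 G^ν ∂f/∂v^ν`. -/
def Sop (L f : Vec m → Vec m → ℝ) (x v : Vec m) : ℝ :=
  ∑ ν, v ν * pdx f ν x v - 2 * ∑ ν, spray L ν x v * pdv f ν x v

section main

variable {Ω : Set (Vec m × Vec m)} {L : Vec m → Vec m → ℝ} {x v : Vec m}

lemma PF.sv (H : PF Ω L) (a : Fin m) : Sm Ω (pdv L a) := H.sm.pdv H.op a

lemma PF.sg (H : PF Ω L) (a b : Fin m) : Sm Ω (fun x v => gmet L x v a b) :=
  (H.sv b).pdv H.op a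

lemma PF.sspray (H : PF Ω L) (a : Fin m) : Sm Ω (spray L a) := by
  unfold spray ginv
  refine (Sm.const _).mul (Sm.sum fun d => (Sm.inv H.sg H.inv a d).mul
    (Sm.sum fun b => Sm.sum fun c => ?_))
  exact (((((H.sg d c).pdx H.op b).add ((H.sg d b).pdx H.op c)).sub
    ((H.sg b c).pdx H.op d)).mul (Sm.coord b)).mul (Sm.coord c)

lemma PF.sN (H : PF Ω L) (a b : Fin m) : Sm Ω (nConn L a b) := (H.sspray a).pdv H.op b

lemma PF.g_symm (H : PF Ω L) (hp : (x, v) ∈ Ω) (a b : Fin m) :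
    gmet L x v a b = gmet L x v b a := pdv_pdv_comm H.sm H.op hp b a

lemma PF.e0 (H : PF Ω L) (hp : (x, v) ∈ Ω) : ∑ i, v i * pdv L i x v = 2 * L x v :=
  euler H.sm H.op hp (H.hom _ hp)

lemma PF.e1 (H : PF Ω L) (hp : (x, v) ∈ Ω) (j : Fin m) :
    ∑ i, v i * gmet L x v j i = pdv L j x v := by
  have h := pdv_congr H.op (fun x v hp => H.e0 hp) hp j
  rw [pdv_vsum (fun i => H.sv i) H.op hp, pdv_smul 2 H.sm H.op hp] at h
  have : ∑ i, v i * gmet L x v j i = ∑ i, v i * pdv (pdv L i) j x v := rfl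
  linarith

lemma PF.e1x (H : PF Ω L) (hp : (x, v) ∈ Ω) (j k : Fin m) :
    ∑ i, v i * pdx (fun x v => gmet L x v j i) k x v = pdx (pdv L j) k x v := by
  have h := pdx_congr H.op (fun x v hp => H.e1 hp j) hp k
  rwa [pdx_vsum (fun i => H.sg j i) H.op hp] at h

lemma PF.e0x (H : PF Ω L) (hp : (x, v) ∈ Ω) (k : Fin m) :
    ∑ i, v i * pdx (pdv L i) k x v = 2 * pdx L k x v := by
  have h := pdx_congr H.op (fun x v hp => H.e0 hp) hp k
  rwa [pdx_vsum (fun i => H.sv i) H.op hp, pdx_smul 2 H.sm H.op hp] at h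

/-- Third derivatives of `L` contracted with `v` vanish. -/
lemma PF.e2 (H : PF Ω L) (hp : (x, v) ∈ Ω) (j k : Fin m) :
    ∑ i, v i * pdv (fun x v => gmet L x v j k) i x v = 0 := by
  have h := pdv_congr H.op (fun x v hp => H.e1 hp j) hp k
  rw [pdv_vsum (fun i => H.sg j i) H.op hp] at h
  have h2 : pdv (pdv L j) k x v = gmet L x v j k := pdv_pdv_comm H.sm H.op hp j k
  have h3 : ∀ i, pdv (fun x v => gmet L x v j k) i x v
      = pdv (fun x v => gmet L x v j i) k x v := by
    intro i
    have a1 : ∀ a, pdv (fun x v => gmet L x v j a) i x v = pdv (pdv (pdv L j) a) i x v :=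
      fun a => pdv_congr H.op (fun x v hp => pdv_pdv_comm H.sm H.op hp a j) hp i
    have a2 : ∀ a, pdv (fun x v => gmet L x v j a) k x v = pdv (pdv (pdv L j) a) k x v :=
      fun a => pdv_congr H.op (fun x v hp => pdv_pdv_comm H.sm H.op hp a j) hp k
    rw [a1, a2]
    exact pdv_pdv_comm (H.sv j) H.op hp _ _
  simp only [h3]
  linarith

/-- Lowered spray. -/
lemma PF.el (H : PF Ω L) (hp : (x, v) ∈ Ω) (a : Fin m) :
    ∑ μ, gmet L x v a μ * spray L μ x v
      = (1/2) * (∑ ν, v ν * pdx (pdv L a) ν x v - pdx L a x v) := by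
  set T : Fin m → ℝ := fun δ => ∑ β, ∑ γ,
      (pdx (fun y w => gmet L y w δ γ) β x v
        + pdx (fun y w => gmet L y w δ β) γ x v
        - pdx (fun y w => gmet L y w β γ) δ x v) * v β * v γ with hT
  have h1 : ∀ μ, spray L μ x v = (1/4) * ((gmet L x v)⁻¹.mulVec T) μ := fun μ => rfl
  have h2 : ∑ μ, gmet L x v a μ * spray L μ x v = (1/4) * T a := by
    have : (gmet L x v).mulVec ((gmet L x v)⁻¹.mulVec T) = T := by
      rw [Matrix.mulVec_mulVec, Matrix.mul_nonsing_inv _ (H.inv _ hp), Matrix.one_mulVec]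
    have h3 := congrFun this a
    rw [← h3]
    conv_rhs => rw [Matrix.mulVec, dotProduct]
    rw [Finset.mul_sum]
    refine Finset.sum_congr rfl fun μ _ => ?_
    rw [h1]; ring
  have h4 : T a = ∑ β, v β * ∑ γ, v γ * pdx (fun y w => gmet L y w a γ) β x v
      + ∑ γ, v γ * ∑ β, v β * pdx (fun y w => gmet L y w a β) γ x v
      - ∑ β, v β * ∑ γ, v γ * pdx (fun y w => gmet L y w β γ) a x v := by
    rw [hT]
    simp only [Finset.mul_sum]
    conv_rhs =>
      enter [1, 2]
      rw [Finset.sum_comm]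
    simp only [← Finset.sum_add_distrib, ← Finset.sum_sub_distrib]
    refine Finset.sum_congr rfl fun β _ => Finset.sum_congr rfl fun γ _ => ?_
    ring
  simp only [H.e1x hp, H.e0x hp] at h4
  rw [h2, h4]; ring

/-- Horizontal part: first derivative of `el` in `x`. -/
lemma PF.E1 (H : PF Ω L) (hp : (x, v) ∈ Ω) (a b : Fin m) :
    2 * ∑ μ, gmet L x v a μ * pdx (spray L μ) b x v
      = Sop L (pdx (pdv L a) b) x v - pdx (pdx L a) b x v := by
  have h := pdx_congr H.op (fun x v hp => H.el hp a) hp b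
  have s1 : ∀ ν, Sm Ω (pdx (pdv L a) ν) := fun ν => (H.sv a).pdx H.op ν
  have s2 : Sm Ω (pdx L a) := H.sm.pdx H.op a
  rw [pdx_sum_mul (fun μ => H.sg a μ) H.sspray H.op hp,
    pdx_smul (1/2) ((Sm.sum fun ν => (Sm.coord ν).mul (s1 ν)).sub s2) H.op hp,
    pdx_sub (Sm.sum fun ν => (Sm.coord ν).mul (s1 ν)) s2 H.op hp,
    pdx_vsum s1 H.op hp, Finset.sum_add_distrib] at h
  have c1 : ∀ ν, pdx (pdx (pdv L a) ν) b x v = pdx (pdx (pdv L a) b) ν x v :=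
    fun ν => pdx_pdx_comm (H.sv a) H.op hp ν b
  have c2 : ∀ μ, pdx (fun x v => gmet L x v a μ) b x v * spray L μ x v
      = spray L μ x v * pdv (pdx (pdv L a) b) μ x v := by
    intro μ
    rw [pdv_pdx_comm (H.sv a) H.op hp b μ, mul_comm]
    congr 1
    exact pdx_congr H.op (fun x v hp => H.g_symm hp a μ) hp b
  simp only [c1, c2] at h
  rw [Sop]
  linarith

/-- lowered connection -/
def nl (L : Vec m → Vec m → ℝ) (a b : Fin m) (x v : Vec m) : ℝ :=
  ∑ μ, gmet L x v a μ * nConn L μ b x v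

lemma PF.snl (H : PF Ω L) (a b : Fin m) : Sm Ω (nl L a b) :=
  Sm.sum fun μ => (H.sg a μ).mul (H.sN μ b)

/-- Vertical derivative of `el`. -/
lemma PF.elv (H : PF Ω L) (hp : (x, v) ∈ Ω) (a b : Fin m) :
    ∑ μ, spray L μ x v * pdv (fun x v => gmet L x v a b) μ x v + nl L a b x v
      = (1/2) * (pdx (pdv L a) b x v + ∑ ν, v ν * pdx (fun x v => gmet L x v a b) ν x v
        - pdx (pdv L b) a x v) := by
  have h := pdv_congr H.op (fun x v hp => H.el hp a) hp b
  have s1 : ∀ ν, Sm Ω (pdx (pdv L a) ν) := fun ν => (H.sv a).pdx H.op ν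
  have s2 : Sm Ω (pdx L a) := H.sm.pdx H.op a
  rw [pdv_sum_mul (fun μ => H.sg a μ) H.sspray H.op hp,
    pdv_smul (1/2) ((Sm.sum fun ν => (Sm.coord ν).mul (s1 ν)).sub s2) H.op hp,
    pdv_sub (Sm.sum fun ν => (Sm.coord ν).mul (s1 ν)) s2 H.op hp,
    pdv_vsum s1 H.op hp, Finset.sum_add_distrib, pdv_pdx_comm H.sm H.op hp] at h
  have c1 : ∀ ν, pdv (pdx (pdv L a) ν) b x v = pdx (fun x v => gmet L x v a b) ν x v := by
    intro ν
    rw [pdv_pdx_comm (H.sv a) H.op hp ν b]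
    exact pdx_congr H.op (fun x v hp => H.g_symm hp b a) hp ν
  have c2 : ∀ μ, pdv (fun x v => gmet L x v a μ) b x v * spray L μ x v
      = spray L μ x v * pdv (fun x v => gmet L x v a b) μ x v := by
    intro μ
    rw [mul_comm]
    congr 1
    have a1 : ∀ c d, pdv (fun x v => gmet L x v a c) d x v = pdv (pdv (pdv L a) c) d x v :=
      fun c d => pdv_congr H.op (fun x v hp => pdv_pdv_comm H.sm H.op hp c a) hp d
    rw [a1, a1]
    exact pdv_pdv_comm (H.sv a) H.op hp _ _
  simp only [c1, c2] at h
  exact h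

lemma PF.E2 (H : PF Ω L) (hp : (x, v) ∈ Ω) (a b : Fin m) :
    2 * nl L a b x v = Sop L (fun x v => gmet L x v a b) x v
      + pdx (pdv L a) b x v - pdx (pdv L b) a x v := by
  have := H.elv hp a b
  rw [Sop]; linarith

lemma Sop_congr {f h : Vec m → Vec m → ℝ} (hO : IsOpen Ω)
    (e : ∀ x v, (x, v) ∈ Ω → f x v = h x v) (hp : (x, v) ∈ Ω) :
    Sop L f x v = Sop L h x v := by
  simp only [Sop, pdx_congr hO e hp, pdv_congr hO e hp]

lemma Sop_sub {f h : Vec m → Vec m → ℝ} (hO : IsOpen Ω) (hf : Sm Ω f) (hh : Sm Ω h)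
    (hp : (x, v) ∈ Ω) :
    Sop L (fun x v => f x v - h x v) x v = Sop L f x v - Sop L h x v := by
  simp only [Sop, pdx_sub hf hh hO hp, pdv_sub hf hh hO hp, mul_sub, Finset.sum_sub_distrib]
  ring

lemma Sop_mul {f h : Vec m → Vec m → ℝ} (hO : IsOpen Ω) (hf : Sm Ω f) (hh : Sm Ω h)
    (hp : (x, v) ∈ Ω) :
    Sop L (fun x v => f x v * h x v) x v
      = Sop L f x v * h x v + f x v * Sop L h x v := by
  simp only [Sop, pdx_mul hf hh hO hp, pdv_mul hf hh hO hp, mul_add, Finset.sum_add_distrib,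
    sub_mul, mul_sub, Finset.sum_mul, Finset.mul_sum]
  have e1 : ∀ i, v i * (pdx f i x v * h x v) = v i * pdx f i x v * h x v := fun i => by ring
  have e2 : ∀ i, v i * (f x v * pdx h i x v) = f x v * (v i * pdx h i x v) := fun i => by ring
  have e3 : ∀ i, 2 * (spray L i x v * (pdv f i x v * h x v))
    = 2 * (spray L i x v * pdv f i x v) * h x v := fun i => by ring
  have e4 : ∀ i, 2 * (spray L i x v * (f x v * pdv h i x v))
    = f x v * (2 * (spray L i x v * pdv h i x v)) := fun i => by ring
  simp only [e1, e2, e3, e4]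
  ring

lemma Sop_sum {F : Fin m → Vec m → Vec m → ℝ} (hO : IsOpen Ω) (hF : ∀ i, Sm Ω (F i))
    (hp : (x, v) ∈ Ω) :
    Sop L (fun x v => ∑ j, F j x v) x v = ∑ j, Sop L (F j) x v := by
  simp only [Sop, pdx_sum hF hO hp, pdv_sum hF hO hp, Finset.mul_sum, Finset.sum_sub_distrib]
  rw [Finset.sum_comm]
  congr 1
  rw [Finset.sum_comm]

lemma PF.E3 (H : PF Ω L) (hp : (x, v) ∈ Ω) (a b : Fin m) :
    Sop L (nl L a b) x v = ∑ μ, (Sop L (fun x v => gmet L x v a μ) x v * nConn L μ b x v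
      + gmet L x v a μ * Sop L (nConn L μ b) x v) := by
  have := Sop_sum (L := L) (F := fun μ x v => gmet L x v a μ * nConn L μ b x v) H.op
    (fun μ => (H.sg a μ).mul (H.sN μ b)) hp
  refine (this : Sop L (nl L a b) x v = _).trans (Finset.sum_congr rfl fun μ _ => ?_)
  exact Sop_mul H.op (H.sg a μ) (H.sN μ b) hp

/-- Symmetry of `H_β p_α`. -/
lemma PF.E5 (H : PF Ω L) (hp : (x, v) ∈ Ω) (a b : Fin m) :
    pdx (pdv L a) b x v - nl L a b x v = pdx (pdv L b) a x v - nl L b a x v := by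
  have h1 := H.E2 hp a b
  have h2 := H.E2 hp b a
  have h3 : Sop L (fun x v => gmet L x v a b) x v = Sop L (fun x v => gmet L x v b a) x v :=
    Sop_congr H.op (fun x v hp => H.g_symm hp a b) hp
  linarith

lemma PF.E5S (H : PF Ω L) (hp : (x, v) ∈ Ω) (a b : Fin m) :
    Sop L (pdx (pdv L a) b) x v - Sop L (nl L a b) x v
      = Sop L (pdx (pdv L b) a) x v - Sop L (nl L b a) x v := by
  rw [← Sop_sub H.op ((H.sv a).pdx H.op b) (H.snl a b) hp,
    ← Sop_sub H.op ((H.sv b).pdx H.op a) (H.snl b a) hp]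
  exact Sop_congr H.op (fun x v hp => H.E5 hp a b) hp

lemma PF.Sg (H : PF Ω L) (hp : (x, v) ∈ Ω) (a b : Fin m) :
    Sop L (fun x v => gmet L x v a b) x v = nl L a b x v + nl L b a x v := by
  have h1 := H.E2 hp a b
  have h2 := H.E5 hp a b
  linarith

/-- Euler relation for the spray: `N^a_i v^i = 2 G^a`. -/
lemma PF.eulerG (H : PF Ω L) (hp : (x, v) ∈ Ω) (a : Fin m) :
    ∑ i, v i * nConn L a i x v = 2 * spray L a x v := by
  have key : ∀ c, ∑ μ, gmet L x v c μ * (∑ i, v i * nConn L μ i x v)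
      = ∑ μ, gmet L x v c μ * (2 * spray L μ x v) := by
    intro c
    have h1 : ∑ i, v i * (∑ μ, spray L μ x v * pdv (fun x v => gmet L x v c i) μ x v
        + nl L c i x v) = ∑ i, v i * ((1/2) * (pdx (pdv L c) i x v
        + ∑ ν, v ν * pdx (fun x v => gmet L x v c i) ν x v - pdx (pdv L i) c x v)) :=
      Finset.sum_congr rfl fun i _ => by rw [H.elv hp c i]
    have h2 : ∑ i, v i * ∑ μ, spray L μ x v * pdv (fun x v => gmet L x v c i) μ x v = 0 := by
      simp only [Finset.mul_sum]
      rw [Finset.sum_comm]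
      refine Finset.sum_eq_zero fun μ _ => ?_
      have h3 := H.e2 hp c μ
      have h4 : ∀ i, pdv (fun x v => gmet L x v c i) μ x v
          = pdv (fun x v => gmet L x v c μ) i x v := by
        intro i
        have a1 : ∀ e d, pdv (fun x v => gmet L x v c e) d x v = pdv (pdv (pdv L c) e) d x v :=
          fun e d => pdv_congr H.op (fun x v hp => pdv_pdv_comm H.sm H.op hp e c) hp d
        rw [a1, a1]
        exact pdv_pdv_comm (H.sv c) H.op hp _ _
      calc _ = spray L μ x v * ∑ i, v i * pdv (fun x v => gmet L x v c μ) i x v := by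
            rw [Finset.mul_sum]
            exact Finset.sum_congr rfl fun i _ => by rw [h4]; ring
        _ = 0 := by rw [h3, mul_zero]
    have h5 : ∑ i, v i * ∑ ν, v ν * pdx (fun x v => gmet L x v c i) ν x v
        = ∑ ν, v ν * pdx (pdv L c) ν x v := by
      simp only [← H.e1x hp, Finset.mul_sum]
      rw [Finset.sum_comm]
      exact Finset.sum_congr rfl fun i _ => Finset.sum_congr rfl fun j _ => by ring
    have h6 : ∑ i, v i * ((1/2) * (pdx (pdv L c) i x v
        + ∑ ν, v ν * pdx (fun x v => gmet L x v c i) ν x v - pdx (pdv L i) c x v))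
        = (1/2) * (∑ i, v i * pdx (pdv L c) i x v
          + ∑ i, v i * ∑ ν, v ν * pdx (fun x v => gmet L x v c i) ν x v
          - ∑ i, v i * pdx (pdv L i) c x v) := by
      rw [← Finset.sum_add_distrib, ← Finset.sum_sub_distrib, Finset.mul_sum]
      exact Finset.sum_congr rfl fun i _ => by ring
    have h7 : ∑ μ, gmet L x v c μ * (∑ i, v i * nConn L μ i x v)
        = ∑ i, v i * nl L c i x v := by
      simp only [nl, Finset.mul_sum]
      rw [Finset.sum_comm]
      exact Finset.sum_congr rfl fun i _ => Finset.sum_congr rfl fun j _ => by ring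
    have h8 : ∑ μ, gmet L x v c μ * (2 * spray L μ x v)
        = 2 * ∑ μ, gmet L x v c μ * spray L μ x v := by
      rw [Finset.mul_sum]
      exact Finset.sum_congr rfl fun i _ => by ring
    rw [h6, h5, H.e0x hp] at h1
    simp only [mul_add, Finset.sum_add_distrib] at h1
    rw [h2] at h1
    rw [h7, h8, H.el hp]
    linarith
  have hv : (gmet L x v).mulVec (fun μ => ∑ i, v i * nConn L μ i x v)
      = (gmet L x v).mulVec (fun μ => 2 * spray L μ x v) := funext key
  have hinj := Matrix.mulVec_injective_of_isUnit
    ((Matrix.isUnit_iff_isUnit_det _).2 (H.inv _ hp))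
  exact congrFun (hinj hv) a

lemma PF.E4 (H : PF Ω L) (hp : (x, v) ∈ Ω) (a b : Fin m) :
    curvEndo L a b x v = 2 * pdx (spray L a) b x v
      - ∑ j, nConn L j b x v * nConn L a j x v - Sop L (nConn L a b) x v := by
  have hx := pdx_congr H.op (fun x v hp => H.eulerG hp a) hp b
  rw [pdx_vsum (fun i => H.sN a i) H.op hp, pdx_smul 2 (H.sspray a) H.op hp] at hx
  have hv : ∀ j, ∑ i, v i * pdv (nConn L a i) j x v = nConn L a j x v := by
    intro j
    have h := pdv_congr H.op (fun x v hp => H.eulerG hp a) hp j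
    rw [pdv_vsum (fun i => H.sN a i) H.op hp, pdv_smul 2 (H.sspray a) H.op hp] at h
    have : pdv (spray L a) j x v = nConn L a j x v := rfl
    linarith
  have h1 : ∑ j, nConn L j b x v * nConn L a j x v
      = ∑ μ, v μ * ∑ j, nConn L j b x v * pdv (nConn L a μ) j x v := by
    rw [Finset.sum_congr rfl fun j _ => by rw [← hv j]]
    simp only [Finset.mul_sum]
    rw [Finset.sum_comm]
    exact Finset.sum_congr rfl fun i _ => Finset.sum_congr rfl fun j _ => by ring
  have h2 : 2 * ∑ ν, spray L ν x v * pdv (nConn L a b) ν x v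
      = ∑ μ, v μ * ∑ ν, nConn L ν μ x v * pdv (nConn L a b) ν x v := by
    simp only [Finset.mul_sum, ← mul_assoc, ← H.eulerG hp, Finset.sum_mul]
    rw [Finset.sum_comm]
  rw [Sop, ← hx, h1, h2]
  simp only [curvEndo, curv, hderiv]
  simp only [← Finset.sum_sub_distrib]
  exact Finset.sum_congr rfl fun i _ => by ring

lemma PF.symm (H : PF Ω L) (hp : (x, v) ∈ Ω) (a b : Fin m) :
    ∑ μ, gmet L x v a μ * curvEndo L μ b x v = ∑ μ, gmet L x v b μ * curvEndo L μ a x v := by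
  have main : ∀ a b, ∑ μ, gmet L x v a μ * curvEndo L μ b x v
      = Sop L (pdx (pdv L a) b) x v - Sop L (nl L a b) x v - pdx (pdx L a) b x v
        + ∑ μ, nl L μ a x v * nConn L μ b x v := by
    intro a b
    have h1 := H.E1 hp a b
    have h3 := H.E3 hp a b
    simp only [H.Sg hp, add_mul, Finset.sum_add_distrib] at h3
    have h4 : ∑ μ, gmet L x v a μ * ∑ j, nConn L j b x v * nConn L μ j x v
        = ∑ j, nl L a j x v * nConn L j b x v := by
      simp only [nl, Finset.mul_sum, Finset.sum_mul]
      rw [Finset.sum_comm]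
      exact Finset.sum_congr rfl fun i _ => Finset.sum_congr rfl fun j _ => by ring
    have h5 : ∑ μ, gmet L x v a μ * curvEndo L μ b x v
        = 2 * ∑ μ, gmet L x v a μ * pdx (spray L μ) b x v
          - ∑ μ, gmet L x v a μ * ∑ j, nConn L j b x v * nConn L μ j x v
          - ∑ μ, gmet L x v a μ * Sop L (nConn L μ b) x v := by
      rw [Finset.mul_sum, ← Finset.sum_sub_distrib, ← Finset.sum_sub_distrib]
      exact Finset.sum_congr rfl fun i _ => by rw [H.E4 hp]; ring
    rw [h5, h4, h1, h3]; ring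
  have q : ∑ μ, nl L μ a x v * nConn L μ b x v = ∑ μ, nl L μ b x v * nConn L μ a x v := by
    simp only [nl, Finset.sum_mul]
    rw [Finset.sum_comm]
    exact Finset.sum_congr rfl fun i _ => Finset.sum_congr rfl fun j _ => by
      rw [H.g_symm hp i j]; ring
  rw [main a b, main b a, q, H.E5S hp a b, pdx_pdx_comm H.sm H.op hp a b]

end main

lemma curvEndo_self (L : Vec m → Vec m → ℝ) (a : Fin m) (x v : Vec m) :
    ∑ b, curvEndo L a b x v * v b = 0 := by
  have h : ∑ b, curvEndo L a b x v * v b = - ∑ b, curvEndo L a b x v * v b := by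
    simp only [curvEndo, Finset.sum_mul, ← Finset.sum_neg_distrib]
    rw [Finset.sum_comm]
    exact Finset.sum_congr rfl fun i _ => Finset.sum_congr rfl fun j _ => by
      simp only [curv]; ring
  linarith

/-- Proposition (Prop. 2.4, Eqs. (mki)-(mkp)): the curvature endomorphism satisfies
`R_v(v)=0`, `g_v(v,R_v(X))=0` and is `g_v`-self-adjoint. -/
theorem statement4 {m : ℕ} (hm : 2 ≤ m)
    (Ω : Set (Vec m × Vec m)) (hΩopen : IsOpen Ω) (hΩne : Ω.Nonempty)
    (hΩslit : ∀ p ∈ Ω, p.2 ≠ 0)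
    (hΩcone : ∀ p ∈ Ω, ∀ s : ℝ, 0 < s → (p.1, s • p.2) ∈ Ω)
    (L : Vec m → Vec m → ℝ)
    (hLsmooth : ContDiffOn ℝ (⊤ : ℕ∞) (fun p : Vec m × Vec m => L p.1 p.2) Ω)
    (hLhom : ∀ p ∈ Ω, ∀ s : ℝ, 0 < s → L p.1 (s • p.2) = s ^ 2 * L p.1 p.2)
    (hLinv : ∀ p ∈ Ω, IsUnit (gmet L p.1 p.2).det)
    : ∀ p ∈ Ω,
      (∀ α, ∑ β, curvEndo L α β p.1 p.2 * p.2 β = 0)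
      ∧ (∀ β, ∑ α, ∑ μ, gmet L p.1 p.2 α μ * p.2 α * curvEndo L μ β p.1 p.2 = 0)
      ∧ (∀ α β, ∑ μ, gmet L p.1 p.2 α μ * curvEndo L μ β p.1 p.2
          = ∑ μ, gmet L p.1 p.2 β μ * curvEndo L μ α p.1 p.2) := by
  have H : PF Ω L := ⟨hΩopen, hLsmooth, hLhom, hLinv⟩
  rintro ⟨x, v⟩ hp
  refine ⟨fun α => curvEndo_self L α x v, fun β => ?_, fun α β => H.symm hp α β⟩
  have h : ∀ α, ∑ μ, gmet L x v α μ * v α * curvEndo L μ β x v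
      = v α * ∑ μ, gmet L x v β μ * curvEndo L μ α x v := by
    intro α
    rw [← H.symm hp α β, Finset.mul_sum]
    exact Finset.sum_congr rfl fun i _ => by ring
  simp only [h, Finset.mul_sum]
  rw [Finset.sum_comm]
  refine Finset.sum_eq_zero fun μ _ => ?_
  have h2 := curvEndo_self L μ x v
  calc _ = gmet L x v β μ * ∑ b, curvEndo L μ b x v * v b := by
        rw [Finset.mul_sum]
        exact Finset.sum_congr rfl fun i _ => by ring
    _ = 0 := by rw [h2, mul_zero]
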